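/- arXiv:2008.00663 — 3 statements merged into one kernel-verified Lean document; each statement's English description precedes it below -/
import Mathlib

section
/- Let m ≥ 3 be odd, q = 2^m, F = GF(q), and let f : F → F be an oval polynomial such that f(x^2) = f(x)^2 for all x ∈ F. Then every nonzero codeword of C̄_f has Hamming weight q-1, q, q+1, or q+2, and the numbers of codewords of these weights are: (q-1)(q-2) of weight q-1, (q-1)(q^2-3q+14)/2 of weight q, 3(q-1)(q-2) of weight q+1, and (q-1)(q^2-3q+4)/2 of weight q+2. -/
/-- The Hamming weight of a vector: the number of nonzero coordinates. -/
def wt {ι F : Type} [Fintype ι] [DecidableEq F] [Zero F] (v : ι → F) : ℕ :=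
  (Finset.univ.filter fun i => v i ≠ 0).card

/-- The codeword of the code `C̄_f` of length `q+2` associated to `(a,b,c) ∈ F³`:
the vector `((a·f(x)+b·x+c)_{x ∈ F}, b+c, a+c)`. -/
def Cbarword {F : Type} [Field F] (f : F → F) (p : F × F × F) : F ⊕ Fin 2 → F :=
  Sum.elim (fun x => p.1 * f x + p.2.1 * x + p.2.2) ![p.2.1 + p.2.2, p.1 + p.2.2]

namespace OvalCode

variable {F : Type} [Field F]

lemma Cbarword_injective {f : F → F} (hf0 : f 0 = 0) :
    Function.Injective (Cbarword f) := by
  rintro ⟨a, b, c⟩ ⟨a', b', c'⟩ h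
  have h0 := congrFun h (Sum.inl 0)
  have h1 := congrFun h (Sum.inr 0)
  have h2 := congrFun h (Sum.inr 1)
  simp [Cbarword, hf0] at h0 h1 h2
  subst h0
  simp_all

/-- Evaluation of codewords at the coordinate `i`, as an additive map of the parameters. -/
def evalHom (f : F → F) (i : F ⊕ Fin 2) : F × F × F →+ F where
  toFun p := Cbarword f p i
  map_zero' := by
    rcases i with x | i
    · simp [Cbarword]
    · fin_cases i <;> simp [Cbarword]
  map_add' p p' := by
    rcases i with x | i
    · simp only [Cbarword, Sum.elim_inl, Prod.fst_add, Prod.snd_add]; ring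
    · fin_cases i <;> simp [Cbarword] <;> ring

lemma eval_pair_surjective {f : F → F} (hbij : Function.Bijective f) (hf1 : f 1 = 1)
    {i j : F ⊕ Fin 2} (hij : i ≠ j) :
    Function.Surjective ((evalHom f i).prod (evalHom f j)) := by
  have key : ∀ i j : F ⊕ Fin 2, i ≠ j → (∃ x, i = Sum.inl x) ∨ (i = Sum.inr 0 ∧ j = Sum.inr 1) →
      ∀ s t, ∃ p, Cbarword f p i = s ∧ Cbarword f p j = t := by
    rintro _ j hij (⟨x, rfl⟩ | ⟨rfl, rfl⟩) s t
    · rcases j with y | j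
      · have hxy : x - y ≠ 0 := sub_ne_zero.2 fun h => hij (by rw [h])
        refine ⟨(0, (s - t) / (x - y), s - (s - t) / (x - y) * x), ?_, ?_⟩
        · simp [Cbarword]
        · simp only [Cbarword, Sum.elim_inl]; field_simp; ring
      · by_cases hx : x = 1
        · subst hx
          fin_cases j
          · exact ⟨(s - t, 0, t), by simp [Cbarword, hf1], by simp [Cbarword]⟩
          · exact ⟨(0, s - t, t), by simp [Cbarword], by simp [Cbarword]⟩
        · fin_cases j
          · have hx' : x - 1 ≠ 0 := sub_ne_zero.2 hx
            refine ⟨(0, (s - t) / (x - 1), t - (s - t) / (x - 1)), ?_, ?_⟩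
            · simp only [Cbarword, Sum.elim_inl]; field_simp; ring
            · simp [Cbarword]
          · have hx' : f x - 1 ≠ 0 :=
              sub_ne_zero.2 fun h => hx (hbij.1 (h.trans hf1.symm))
            refine ⟨((s - t) / (f x - 1), 0, t - (s - t) / (f x - 1)), ?_, ?_⟩
            · simp only [Cbarword, Sum.elim_inl]; field_simp; ring
            · simp [Cbarword]
    · exact ⟨(t, s, 0), by simp [Cbarword], by simp [Cbarword]⟩
  rintro ⟨s, t⟩
  suffices h : ∃ p, Cbarword f p i = s ∧ Cbarword f p j = t by
    obtain ⟨p, h1, h2⟩ := h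
    exact ⟨p, Prod.ext h1 h2⟩
  rcases i with x | i
  · exact key _ _ hij (Or.inl ⟨x, rfl⟩) s t
  · rcases j with y | j
    · obtain ⟨p, h1, h2⟩ := key _ _ hij.symm (Or.inl ⟨y, rfl⟩) t s
      exact ⟨p, h2, h1⟩
    · fin_cases i <;> fin_cases j
      · exact absurd rfl hij
      · exact key _ _ hij (Or.inr ⟨rfl, rfl⟩) s t
      · obtain ⟨p, h1, h2⟩ := key _ _ hij.symm (Or.inr ⟨rfl, rfl⟩) t s
        exact ⟨p, h2, h1⟩
      · exact absurd rfl hij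

lemma eq_zero_or_one_of_pow_four [Fintype F] {m : ℕ} (hmodd : Odd m) (hcard : Fintype.card F = 2 ^ m)
    {x : F} (hx : x ^ 4 = x) : x = 0 ∨ x = 1 := by
  obtain ⟨k, rfl⟩ := hmodd
  have h4 : ∀ k : ℕ, x ^ 4 ^ k = x := by
    intro k
    induction k with
    | zero => simp
    | succ k ih => rw [pow_succ, pow_mul, ih, hx]
  have h := FiniteField.pow_card x
  rw [hcard, pow_succ, pow_mul 2 2 k, show 2 ^ 2 = 4 from rfl, pow_mul, h4] at h
  have : x * (x - 1) = 0 := by linear_combination h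
  simpa [sub_eq_zero] using this

lemma card_ker_mul_card {G H : Type} [AddGroup G] [AddGroup H] (g : G →+ H)
    (hg : Function.Surjective g) : Nat.card g.ker * Nat.card H = Nat.card G := by
  rw [← g.ker.card_mul_index, AddSubgroup.index_ker, AddMonoidHom.range_eq_top.2 hg,
    AddSubgroup.card_top]

variable [Fintype F] [DecidableEq F]

/-- The number of coordinates of `Cbarword f p` that vanish. -/
def zeros (f : F → F) (p : F × F × F) : ℕ :=
  (Finset.univ.filter fun i => Cbarword f p i = 0).card

/-- The number of roots of `a f(x) + b x + c`. -/
def roots (f : F → F) (p : F × F × F) : ℕ :=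
  (Finset.univ.filter fun x => p.1 * f x + p.2.1 * x + p.2.2 = 0).card

lemma wt_add_zeros (f : F → F) (p : F × F × F) :
    wt (Cbarword f p) + zeros f p = Fintype.card F + 2 := by
  have h := Finset.card_filter_add_card_filter_not
    (s := (Finset.univ : Finset (F ⊕ Fin 2))) (fun i => Cbarword f p i = 0)
  rw [Finset.card_univ, Fintype.card_sum, Fintype.card_fin] at h
  unfold wt zeros
  rw [add_comm]
  exact h

lemma zeros_eq (f : F → F) (p : F × F × F) :
    zeros f p = roots f p + (if p.2.1 + p.2.2 = 0 then 1 else 0)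
      + (if p.1 + p.2.2 = 0 then 1 else 0) := by
  rw [zeros, roots, Finset.card_filter, Finset.card_filter, Fintype.sum_sum_type,
    Fin.sum_univ_two, ← add_assoc]
  rfl

lemma card_codewords (f : F → F) (hf0 : f 0 = 0) {k w : ℕ} (hk : w + k = Fintype.card F + 2) :
    Nat.card {v : F ⊕ Fin 2 → F // (∃ p : F × F × F, v = Cbarword f p) ∧ wt v = w}
      = (Finset.univ.filter fun p => zeros f p = k).card := by
  rw [← Fintype.card_subtype, ← Nat.card_eq_fintype_card]
  refine (Nat.card_congr (Equiv.ofBijective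
    (fun p : {p // zeros f p = k} => (⟨Cbarword f p.1, ⟨p.1, rfl⟩, ?_⟩ :
      {v : F ⊕ Fin 2 → F // (∃ p : F × F × F, v = Cbarword f p) ∧ wt v = w})) ⟨?_, ?_⟩)).symm
  · have := wt_add_zeros f p.1
    have := p.2
    omega
  · intro p p' h
    exact Subtype.ext (Cbarword_injective hf0 (congrArg Subtype.val h))
  · rintro ⟨_, ⟨p, rfl⟩, hp⟩
    refine ⟨⟨p, ?_⟩, rfl⟩
    have := wt_add_zeros f p
    omega

/-! ### Power moments -/

lemma card_eval_eq_zero (f : F → F) (i : F ⊕ Fin 2) :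
    (Finset.univ.filter fun p => Cbarword f p i = 0).card = Fintype.card F ^ 2 := by
  have hs : Function.Surjective (evalHom f i) := fun s => ⟨(0, 0, s), by
    rcases i with x | i
    · simp [evalHom, Cbarword]
    · fin_cases i <;> simp [evalHom, Cbarword]⟩
  have h := card_ker_mul_card _ hs
  have hk : Nat.card (evalHom f i).ker
      = (Finset.univ.filter fun p => Cbarword f p i = 0).card := by
    rw [← Fintype.card_subtype, ← Nat.card_eq_fintype_card]
    rfl
  rw [hk] at h
  simp only [Nat.card_eq_fintype_card, Fintype.card_prod] at h
  have hq : 0 < Fintype.card F := Fintype.card_pos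
  exact Nat.eq_of_mul_eq_mul_right hq (by rw [h]; ring)

lemma card_eval_pair_eq_zero {f : F → F} (hbij : Function.Bijective f) (hf1 : f 1 = 1)
    {i j : F ⊕ Fin 2} (hij : i ≠ j) :
    (Finset.univ.filter fun p => Cbarword f p i = 0 ∧ Cbarword f p j = 0).card
      = Fintype.card F := by
  have h := card_ker_mul_card _ (eval_pair_surjective hbij hf1 hij)
  have hk : Nat.card ((evalHom f i).prod (evalHom f j)).ker
      = (Finset.univ.filter fun p => Cbarword f p i = 0 ∧ Cbarword f p j = 0).card := by
    rw [← Fintype.card_subtype, ← Nat.card_eq_fintype_card]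
    refine Nat.card_congr (Equiv.subtypeEquivRight fun p => ?_)
    rw [AddMonoidHom.mem_ker]
    exact Prod.mk_eq_zero
  rw [hk] at h
  simp only [Nat.card_eq_fintype_card, Fintype.card_prod] at h
  have hq : 0 < Fintype.card F := Fintype.card_pos
  exact Nat.eq_of_mul_eq_mul_right (Nat.mul_pos hq hq) (by rw [h])

lemma sum_zeros (f : F → F) :
    ∑ p, zeros f p = (Fintype.card F + 2) * Fintype.card F ^ 2 := by
  simp only [zeros, Finset.card_filter]
  rw [Finset.sum_comm]
  simp_rw [← Finset.card_filter, card_eval_eq_zero]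
  simp

lemma sum_zeros_sq {f : F → F} (hbij : Function.Bijective f) (hf1 : f 1 = 1) :
    ∑ p, zeros f p ^ 2 = (Fintype.card F + 2) * Fintype.card F ^ 2
      + (Fintype.card F + 2) * (Fintype.card F + 1) * Fintype.card F := by
  have h : ∀ p, zeros f p ^ 2 =
      ∑ i, ∑ j, if Cbarword f p i = 0 ∧ Cbarword f p j = 0 then 1 else 0 := by
    intro p
    rw [zeros, Finset.card_filter, sq, Finset.sum_mul_sum]
    simp_rw [ite_zero_mul_ite_zero, one_mul]
  simp_rw [h]
  rw [Finset.sum_comm]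
  have hi : ∀ i : F ⊕ Fin 2,
      ∑ p, ∑ j, (if Cbarword f p i = 0 ∧ Cbarword f p j = 0 then 1 else 0)
        = Fintype.card F ^ 2 + (Fintype.card F + 1) * Fintype.card F := by
    intro i
    rw [Finset.sum_comm, ← Finset.add_sum_erase _ _ (Finset.mem_univ i)]
    congr 1
    · simp_rw [and_self, ← Finset.card_filter, card_eval_eq_zero]
    · rw [Finset.sum_congr rfl fun j hj => by
        rw [← Finset.card_filter, card_eval_pair_eq_zero hbij hf1 (Finset.ne_of_mem_erase hj).symm]]
      simp
  simp_rw [hi]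
  simp
  ring

/-! ### Root counts -/

lemma roots_eq_one_of_left {f : F → F} {a b c : F} (ha : a = 0) (hb : b ≠ 0) :
    roots f (a, b, c) = 1 := by
  subst ha
  rw [roots, Finset.card_eq_one]
  refine ⟨-c / b, ?_⟩
  ext x
  simp only [Finset.mem_filter, Finset.mem_univ, true_and, Finset.mem_singleton]
  rw [eq_div_iff hb]
  constructor <;> intro h <;> linear_combination h

lemma roots_eq_one_of_right {f : F → F} (hbij : Function.Bijective f) {a b c : F}
    (ha : a ≠ 0) (hb : b = 0) : roots f (a, b, c) = 1 := by
  subst hb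
  obtain ⟨x₀, hx₀⟩ := hbij.2 (-c / a)
  rw [roots, Finset.card_eq_one]
  refine ⟨x₀, ?_⟩
  ext x
  simp only [Finset.mem_filter, Finset.mem_univ, true_and, Finset.mem_singleton]
  rw [← hbij.1.eq_iff (b := x₀), hx₀, eq_div_iff ha]
  constructor <;> intro h <;> linear_combination h

lemma roots_eq_zero_or_two [CharP F 2] {f : F → F}
    (hoval : ∀ a : F, Function.Bijective
      fun x : F => (f (x + a) + f a) * x ^ (Fintype.card F - 2))
    (hq : 3 ≤ Fintype.card F) {a b c : F} (ha : a ≠ 0) (hb : b ≠ 0) :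
    roots f (a, b, c) = 0 ∨ roots f (a, b, c) = 2 := by
  rw [or_iff_not_imp_left, roots, Finset.card_eq_zero, ← ne_eq, ← Finset.nonempty_iff_ne_empty]
  rintro ⟨x, hx⟩
  simp only [Finset.mem_filter, Finset.mem_univ, true_and] at hx
  have hinv : ∀ t : F, t ≠ 0 → t ^ (Fintype.card F - 2) * t = 1 := fun t ht => by
    rw [← pow_succ, show Fintype.card F - 2 + 1 = Fintype.card F - 1 by omega,
      FiniteField.pow_card_sub_one_eq_one t ht]
  obtain ⟨t, ht : (f (t + x) + f x) * t ^ (Fintype.card F - 2) = b / a⟩ := (hoval x).2 (b / a)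
  have ht0 : t ≠ 0 := by
    rintro rfl
    rw [zero_pow (by omega : Fintype.card F - 2 ≠ 0), mul_zero] at ht
    exact div_ne_zero hb ha ht.symm
  have h2 : (2 : F) = 0 := CharTwo.two_eq_zero
  have hiff : ∀ u, u ≠ 0 → (a * f (u + x) + b * (u + x) + c = 0 ↔ u = t) := by
    intro u hu
    rw [← (hoval x).1.eq_iff (b := t)]
    rw [ht, eq_div_iff ha]
    have hi := hinv u hu
    constructor <;> intro h
    · refine mul_right_cancel₀ hu ?_
      linear_combination (a * (f (u + x) + f x)) * hi + h + hx - (b * u + b * x + c) * h2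
    · linear_combination u * h - (a * (f (u + x) + f x)) * hi - hx + (b * u + b * x + c) * h2
  rw [Finset.card_eq_two]
  refine ⟨x, t + x, by simpa using ht0, ?_⟩
  ext y
  simp only [Finset.mem_filter, Finset.mem_univ, true_and, Finset.mem_insert, Finset.mem_singleton]
  by_cases hy : y = x
  · simp [hy, hx]
  · have := hiff (y - x) (sub_ne_zero.2 hy)
    rw [sub_add_cancel] at this
    rw [this, sub_eq_iff_eq_add]
    simp [hy]

lemma roots_diag_eq_zero [CharP F 2] {f : F → F} {m : ℕ} (hmodd : Odd m)
    (hcard : Fintype.card F = 2 ^ m) (hf0 : f 0 = 0) (hf1 : f 1 = 1)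
    (hfrob : ∀ x : F, f (x ^ 2) = f x ^ 2) {a : F} (ha : a ≠ 0) (h2 : roots f (a, a, a) ≤ 2) :
    roots f (a, a, a) = 0 := by
  rw [roots, Finset.card_eq_zero, Finset.filter_eq_empty_iff]
  intro x _ hx
  have htwo : (2 : F) = 0 := CharTwo.two_eq_zero
  have hmem : ∀ y : F, a * f y + a * y + a = 0 ↔ f y + y + 1 = 0 := fun y => by
    rw [← mul_right_inj' ha (b := f y + y + 1), mul_zero, mul_add, mul_add, mul_one]
  have hsq : ∀ y : F, f y + y + 1 = 0 → f (y ^ 2) + y ^ 2 + 1 = 0 := fun y hy => by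
    rw [hfrob]
    linear_combination (f y + y + 1) * hy - (f y * y + f y + y) * htwo
  simp only [hmem] at hx
  have hx01 : x = 0 ∨ x = 1 := by
    by_contra hne
    have hx1 : x ^ 2 ≠ x := fun h => hne (eq_zero_or_one_of_pow_four hmodd hcard (by
      linear_combination (x ^ 2 + x + 1) * h))
    have hx2 : x ^ 4 ≠ x := fun h => hne (eq_zero_or_one_of_pow_four hmodd hcard h)
    have hx3 : x ^ 4 ≠ x ^ 2 := fun h => hx1 (by
      have : (x ^ 2 - x) ^ 2 = 0 := by linear_combination h + (x ^ 2 - x ^ 3) * htwo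
      exact sub_eq_zero.1 (pow_eq_zero_iff two_ne_zero |>.1 this))
    have hsub : ({x, x ^ 2, x ^ 4} : Finset F) ⊆
        Finset.univ.filter fun x => a * f x + a * x + a = 0 := by
      intro y hy
      simp only [Finset.mem_insert, Finset.mem_singleton] at hy
      simp only [Finset.mem_filter, Finset.mem_univ, true_and, hmem]
      rcases hy with rfl | rfl | rfl
      · exact hx
      · exact hsq _ hx
      · rw [show x ^ 4 = (x ^ 2) ^ 2 by ring]
        exact hsq _ (hsq _ hx)
    have h3 := (Finset.card_le_card hsub).trans h2
    rw [Finset.card_eq_three.2 ⟨x, x ^ 2, x ^ 4, hx1.symm, hx2.symm, hx3.symm, rfl⟩] at h3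
    omega
  rcases hx01 with rfl | rfl
  · simp [hf0] at hx
  · rw [hf1] at hx
    exact one_ne_zero (α := F) (by linear_combination hx - htwo)

/-- The sign attached to the pair `(a, c)`; the parity of `zeros f (a, b, c)` is the product of
the signs of `(a, c)` and `(b, c)`. -/
def sign (a c : F) : ℤ := (if a = 0 then -1 else 1) * (if a = c then -1 else 1)

lemma zeros_zero (f : F → F) : zeros f 0 = Fintype.card F + 2 := by
  simp [zeros_eq, roots]

lemma zeros_le_and_parity [CharP F 2] {f : F → F} {m : ℕ} (hmodd : Odd m)
    (hq : 3 ≤ Fintype.card F) (hcard : Fintype.card F = 2 ^ m) (hbij : Function.Bijective f)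
    (hf0 : f 0 = 0) (hf1 : f 1 = 1)
    (hoval : ∀ a : F, Function.Bijective
      fun x : F => (f (x + a) + f a) * x ^ (Fintype.card F - 2))
    (hfrob : ∀ x : F, f (x ^ 2) = f x ^ 2) {p : F × F × F} (hp : p ≠ 0) :
    zeros f p ≤ 3 ∧ (-1 : ℤ) ^ zeros f p = sign p.1 p.2.2 * sign p.2.1 p.2.2 := by
  obtain ⟨a, b, c⟩ := p
  simp only [zeros_eq, CharTwo.add_eq_zero, sign]
  by_cases ha : a = 0 <;> by_cases hb : b = 0
  · have hc : c ≠ 0 := fun hc => hp (by simp [ha, hb, hc])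
    have hN : roots f (a, b, c) = 0 := by simp [roots, ha, hb, hc]
    rw [hN]
    simp [ha, hb, hc.symm]
  · rw [roots_eq_one_of_left ha hb]
    by_cases hac : a = c <;> by_cases hbc : b = c <;> simp [hac, hbc] <;> simp_all
  · rw [roots_eq_one_of_right hbij ha hb]
    by_cases hac : a = c <;> by_cases hbc : b = c <;> simp [hac, hbc] <;> simp_all
  · have hN := roots_eq_zero_or_two hoval hq (c := c) ha hb
    by_cases hac : a = c <;> by_cases hbc : b = c
    · subst hac hbc
      rw [roots_diag_eq_zero hmodd hcard hf0 hf1 hfrob ha (by omega)]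
      simp [ha]
    all_goals rcases hN with hN | hN <;> rw [hN] <;> simp [ha, hb, hac, hbc] <;> simp_all

lemma sum_sign (c : F) :
    ∑ a, sign a c = if c = 0 then (Fintype.card F : ℤ) else Fintype.card F - 4 := by
  have h : ∀ a, sign a c = 1 - 2 * (if a = 0 then 1 else 0) - 2 * (if a = c then 1 else 0)
      + 4 * (if a = 0 then (if c = 0 then 1 else 0) else 0) := by
    intro a
    unfold sign
    by_cases ha : a = 0 <;> by_cases hc : c = 0 <;> by_cases hac : a = c <;> simp_all
  simp only [h, Finset.sum_add_distrib, Finset.sum_sub_distrib, ← Finset.mul_sum,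
    Finset.sum_ite_eq', Finset.mem_univ, if_true, Finset.sum_const, Finset.card_univ]
  split_ifs <;> simp <;> ring

lemma sum_sign_mul_sign :
    ∑ p : F × F × F, sign p.1 p.2.2 * sign p.2.1 p.2.2
      = (Fintype.card F : ℤ) ^ 2 + (Fintype.card F - 1) * (Fintype.card F - 4) ^ 2 := by
  have h : ∑ p : F × F × F, sign p.1 p.2.2 * sign p.2.1 p.2.2 = ∑ c, (∑ a : F, sign a c) ^ 2 := by
    simp only [Fintype.sum_prod_type, sq, Finset.sum_mul_sum]
    rw [Finset.sum_congr rfl fun _ _ => Finset.sum_comm, Finset.sum_comm]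
  rw [h, ← Finset.add_sum_erase _ _ (Finset.mem_univ 0), sum_sign, if_pos rfl]
  rw [Finset.sum_congr rfl fun c hc => by rw [sum_sign, if_neg (Finset.ne_of_mem_erase hc)]]
  have hq : 1 ≤ Fintype.card F := Fintype.card_pos
  simp [Nat.cast_sub hq]

lemma sum_comp_zeros {f : F → F} (hz : ∀ p, p ≠ 0 → zeros f p ≤ 3)
    (hq : 2 ≤ Fintype.card F) (g : ℕ → ℤ) :
    ∑ p, g (zeros f p) = g (Fintype.card F + 2)
      + ∑ k ∈ Finset.range 4, ((Finset.univ.filter fun p => zeros f p = k).card : ℤ) * g k := by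
  have h : ∀ p, g (zeros f p) = (if p = 0 then g (Fintype.card F + 2) else 0)
      + ∑ k ∈ Finset.range 4, (if zeros f p = k then 1 else 0) * g k := by
    intro p
    by_cases hp : p = 0
    · subst hp
      rw [if_pos rfl, zeros_zero, Finset.sum_eq_zero, add_zero]
      intro k hk
      rw [if_neg (by rw [Finset.mem_range] at hk; omega), zero_mul]
    · have := hz p hp
      simp [hp, show zeros f p < 4 by omega]
  simp_rw [h]
  rw [Finset.sum_add_distrib, Finset.sum_comm]
  simp_rw [← Finset.sum_mul, Finset.sum_boole]
  simp

end OvalCode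

/-- **Theorem (weight distribution of `C̄_f`).**  Let `m ≥ 3` be odd, `q = 2^m`,
`F = GF(q)` and let `f` be an oval polynomial over `F` with `f(x²) = f(x)²`
for all `x`.  Then every nonzero codeword of `C̄_f` has Hamming weight `q-1`,
`q`, `q+1` or `q+2`, and the numbers of codewords of those weights are
`(q-1)(q-2)`, `(q-1)(q²-3q+14)/2`, `3(q-1)(q-2)` and `(q-1)(q²-3q+4)/2`
respectively. -/
theorem stmt_16 (m : ℕ) (hm : 3 ≤ m) (hmodd : Odd m)
    (F : Type) [Field F] [Fintype F] [DecidableEq F] (hcard : Fintype.card F = 2 ^ m)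
    (f : F → F)
    (hbij : Function.Bijective f) (hf0 : f 0 = 0) (hf1 : f 1 = 1)
    (hoval : ∀ a : F, Function.Bijective fun x : F => (f (x + a) + f a) * x ^ (2 ^ m - 2))
    (hfrob : ∀ x : F, f (x ^ 2) = f x ^ 2) :
    (∀ v : F ⊕ Fin 2 → F, (∃ p : F × F × F, v = Cbarword f p) → v ≠ 0 →
        wt v = 2 ^ m - 1 ∨ wt v = 2 ^ m ∨ wt v = 2 ^ m + 1 ∨ wt v = 2 ^ m + 2)
    ∧ Nat.card {v : F ⊕ Fin 2 → F //
          (∃ p : F × F × F, v = Cbarword f p) ∧ wt v = 2 ^ m - 1}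
        = (2 ^ m - 1) * (2 ^ m - 2)
    ∧ 2 * Nat.card {v : F ⊕ Fin 2 → F //
          (∃ p : F × F × F, v = Cbarword f p) ∧ wt v = 2 ^ m}
        = (2 ^ m - 1) * ((2 ^ m) ^ 2 - 3 * 2 ^ m + 14)
    ∧ Nat.card {v : F ⊕ Fin 2 → F //
          (∃ p : F × F × F, v = Cbarword f p) ∧ wt v = 2 ^ m + 1}
        = 3 * (2 ^ m - 1) * (2 ^ m - 2)
    ∧ 2 * Nat.card {v : F ⊕ Fin 2 → F //
          (∃ p : F × F × F, v = Cbarword f p) ∧ wt v = 2 ^ m + 2}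
        = (2 ^ m - 1) * ((2 ^ m) ^ 2 - 3 * 2 ^ m + 4) := by
  have hq8 : 2 ^ 3 ≤ 2 ^ m := Nat.pow_le_pow_right (by norm_num) hm
  have hchar : CharP F 2 := charP_of_card_eq_prime_pow hcard
  rw [← hcard] at hoval hq8 ⊢
  have hz : ∀ p : F × F × F, p ≠ 0 → _ := fun p hp =>
    OvalCode.zeros_le_and_parity hmodd (by omega) hcard hbij hf0 hf1 hoval hfrob hp
  have hsum := OvalCode.sum_comp_zeros (fun p hp => (hz p hp).1) (by omega)
  have hm0 := hsum fun _ => 1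
  have hm1 := hsum fun k => k
  have hm2 := hsum fun k => (k : ℤ) ^ 2
  have hms := hsum fun k => (-1) ^ k
  have heven : Even (Fintype.card F) := by
    rw [hcard]
    exact (even_two).pow_of_ne_zero (by omega)
  have hpar : ∑ p, (-1 : ℤ) ^ OvalCode.zeros f p
      = ∑ p : F × F × F, OvalCode.sign p.1 p.2.2 * OvalCode.sign p.2.1 p.2.2 :=
    Finset.sum_congr rfl fun p _ => by
      by_cases hp : p = 0
      · subst hp
        rw [OvalCode.zeros_zero, (heven.add even_two).neg_one_pow]
        simp [OvalCode.sign]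
      · exact (hz p hp).2
  rw [hpar, OvalCode.sum_sign_mul_sign, (heven.add even_two).neg_one_pow] at hms
  rw [← Nat.cast_sum, OvalCode.sum_zeros] at hm1
  have h2 := congrArg (Nat.cast : ℕ → ℤ) (OvalCode.sum_zeros_sq hbij hf1)
  push_cast at h2
  rw [h2] at hm2
  simp only [Finset.sum_const, Finset.card_univ, Fintype.card_prod] at hm0
  simp only [Finset.sum_range_succ, Finset.sum_range_zero] at hm0 hm1 hm2 hms
  push_cast at hm0 hm1 hm2 hms
  have hw : ∀ {k w : ℕ}, w + k = Fintype.card F + 2 → _ := fun h =>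
    OvalCode.card_codewords f hf0 h
  rw [hw (k := 3) (by omega), hw (k := 2) (by omega), hw (k := 1) (by omega),
    hw (k := 0) (by omega)]
  refine ⟨?_, ?_⟩
  · rintro _ ⟨p, rfl⟩ hp
    have hp0 : p ≠ 0 := by
      rintro rfl
      refine hp (funext fun i => ?_)
      exact (OvalCode.evalHom f i).map_zero
    have := (hz p hp0).1
    have := OvalCode.wt_add_zeros f p
    omega
  generalize Fintype.card F = q at *
  generalize (Finset.univ.filter fun p => OvalCode.zeros f p = 0).card = A0 at *
  generalize (Finset.univ.filter fun p => OvalCode.zeros f p = 1).card = A1 at *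
  generalize (Finset.univ.filter fun p => OvalCode.zeros f p = 2).card = A2 at *
  generalize (Finset.univ.filter fun p => OvalCode.zeros f p = 3).card = A3 at *
  have hq3 : 3 * q ≤ q ^ 2 := by nlinarith
  zify [show 1 ≤ q by omega, show 2 ≤ q by omega, hq3]
  refine ⟨?_, ?_, ?_, ?_⟩ <;> ring_nf at * <;> linarith
end

section
/- Let C be a linear code of length n and dimension k over a finite field GF(q) that is near MDS, i.e., the minimum Hamming weight of a nonzero codeword of C is n-k and the minimum Hamming weight of a nonzero codeword of the dual code C^⊥ is k. Then for every codeword c of C of Hamming weight n-k there exists a codeword c^⊥ of C^⊥ of Hamming weight k whose support is disjoint from the support of c, and c^⊥ is unique up to a nonzero scalar multiple. In particular, the number of codewords of weight n-k in C equals the number of codewords of weight k in C^⊥. -/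
open Module

section NearMDS

variable {ι F : Type} [Fintype ι] [Field F]

/-- The dual code with respect to the standard inner product. -/
def dualCode (C : Submodule F (ι → F)) : Submodule F (ι → F) where
  carrier := {v | ∀ c ∈ C, ∑ i, v i * c i = 0}
  zero_mem' := by simp
  add_mem' := by
    intro v w hv hw c hc
    simp [add_mul, Finset.sum_add_distrib, hv c hc, hw c hc]
  smul_mem' := by
    intro a v hv c hc
    simp [mul_assoc, ← Finset.mul_sum, hv c hc]

theorem mem_dualCode {C : Submodule F (ι → F)} {v : ι → F} :
    v ∈ dualCode C ↔ ∀ c ∈ C, ∑ i, v i * c i = 0 :=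
  Iff.rfl

theorem dualCode_eq_orthogonal [DecidableEq ι] (C : Submodule F (ι → F)) :
    dualCode C = LinearMap.BilinForm.orthogonal (Matrix.toBilin' (1 : Matrix ι ι F)) C := by
  ext v
  simp [mem_dualCode, LinearMap.BilinForm.mem_orthogonal_iff, Matrix.toBilin'_apply', dotProduct,
    mul_comm]

theorem nondegenerate_toBilin'_one [DecidableEq ι] :
    (Matrix.toBilin' (1 : Matrix ι ι F)).Nondegenerate :=
  LinearMap.BilinForm.nondegenerate_toBilin'_of_det_ne_zero' _ (by simp)

theorem finrank_dualCode (C : Submodule F (ι → F)) :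
    finrank F (dualCode C) = Fintype.card ι - finrank F C := by
  classical
  rw [dualCode_eq_orthogonal, LinearMap.BilinForm.finrank_orthogonal nondegenerate_toBilin'_one,
    finrank_fintype_fun_eq_card]

theorem dualCode_dualCode (C : Submodule F (ι → F)) : dualCode (dualCode C) = C := by
  classical
  rw [dualCode_eq_orthogonal, dualCode_eq_orthogonal]
  refine LinearMap.BilinForm.orthogonal_orthogonal nondegenerate_toBilin'_one ?_ C
  intro x y h
  simpa [Matrix.toBilin'_apply', dotProduct_comm] using h

/-- If a nonzero codeword vanishes on a set of `dim C` coordinates, then these coordinates support a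
nonzero dual codeword. -/
theorem exists_dualCode_ne_zero_of_vanishing {C : Submodule F (ι → F)} {Z : Finset ι}
    (hZ : Z.card = finrank F C) {c : ι → F} (hc : c ∈ C) (hc0 : c ≠ 0)
    (hcZ : ∀ i ∈ Z, c i = 0) :
    ∃ d ∈ dualCode C, d ≠ 0 ∧ ∀ i ∉ Z, d i = 0 := by
  classical
  let f : C →ₗ[F] (Z → F) := (LinearMap.funLeft F F ((↑) : Z → ι)).comp C.subtype
  have hf : ¬ Function.Injective f := by
    intro h
    have : (⟨c, hc⟩ : C) = 0 := h (by ext i; simpa [f] using hcZ i i.2)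
    exact hc0 (congrArg Subtype.val this)
  rw [LinearMap.injective_iff_surjective_of_finrank_eq_finrank (by simp [hZ]),
    ← LinearMap.range_eq_top] at hf
  obtain ⟨g, hg0, hg⟩ := Submodule.exists_le_ker_of_lt_top _ (lt_top_iff_ne_top.2 hf)
  have hgf (x : Z → F) : g x = ∑ i, g (Pi.single i 1) * x i := by
    rw [LinearMap.pi_apply_eq_sum_univ g x]
    exact Finset.sum_congr rfl fun i _ => by
      rw [smul_eq_mul, mul_comm]; congr 2; ext j; simp [Pi.single_apply, eq_comm]
  let d : ι → F := fun i => if h : i ∈ Z then g (Pi.single ⟨i, h⟩ 1) else 0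
  have hdZ (i : Z) : d i = g (Pi.single i 1) := by simp [d]
  have hd (i : ι) (hi : i ∉ Z) : d i = 0 := by simp [d, hi]
  refine ⟨d, fun c' hc' => ?_, fun h => hg0 ?_, hd⟩
  · have h0 : g (f ⟨c', hc'⟩) = 0 := hg (LinearMap.mem_range_self f _)
    rw [hgf] at h0
    rw [← h0, ← Finset.sum_subset (Finset.subset_univ Z) (fun i _ hi => by simp [hd i hi]),
      ← Finset.sum_coe_sort]
    exact Finset.sum_congr rfl fun i _ => by rw [hdZ]; rfl
  · ext i
    simp [← hdZ, h]

variable [DecidableEq F]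

theorem card_filter_eq_zero (c : ι → F) :
    (Finset.univ.filter fun i => c i = 0).card = Fintype.card ι - wt c := by
  have := Finset.card_filter_add_card_filter_not (s := Finset.univ) (fun i => c i = 0)
  rw [Finset.card_univ] at this
  unfold wt
  simp only [ne_eq]
  omega

theorem wt_le_card {v : ι → F} {Z : Finset ι} (h : ∀ i ∉ Z, v i = 0) : wt v ≤ Z.card :=
  Finset.card_le_card fun i hi => by
    by_contra hiZ
    exact (Finset.mem_filter.1 hi).2 (h i hiZ)

theorem wt_lt_card {v : ι → F} {Z : Finset ι} (h : ∀ i ∉ Z, v i = 0) {j : ι} (hj : j ∈ Z)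
    (hvj : v j = 0) : wt v < Z.card := by
  classical
  refine (wt_le_card (Z := Z.erase j) fun i hi => ?_).trans_lt (Finset.card_erase_lt_of_mem hj)
  by_cases hij : i = j
  · rwa [hij]
  · exact h i fun hiZ => hi (Finset.mem_erase.2 ⟨hij, hiZ⟩)

theorem wt_pos {v : ι → F} (h : v ≠ 0) : 0 < wt v := by
  obtain ⟨i, hi⟩ := Function.ne_iff.1 h
  exact Finset.card_pos.2 ⟨i, by simpa using hi⟩

theorem ne_zero_of_wt_pos {v : ι → F} (h : 0 < wt v) : v ≠ 0 := by
  rintro rfl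
  simp [wt] at h

/-- Two codewords supported on a common set of at most minimum-distance size are proportional. -/
theorem exists_smul_eq_of_support_subset {D : Submodule F (ι → F)} {Z : Finset ι}
    (hD : ∀ v ∈ D, v ≠ 0 → Z.card ≤ wt v) {d d' : ι → F} (hd : d ∈ D) (hd' : d' ∈ D)
    (hd0 : d ≠ 0) (hd'0 : d' ≠ 0) (hdZ : ∀ i ∉ Z, d i = 0) (hd'Z : ∀ i ∉ Z, d' i = 0) :
    ∃ a : F, a ≠ 0 ∧ d' = a • d := by
  obtain ⟨j, hj⟩ := Function.ne_iff.1 hd0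
  have hjZ : j ∈ Z := by
    by_contra h
    exact hj (hdZ j h)
  have key : d' - (d' j / d j) • d = 0 := by
    by_contra h
    refine (wt_lt_card (v := d' - (d' j / d j) • d) (fun i hi => ?_) hjZ ?_).not_ge
      (hD _ (D.sub_mem hd' (D.smul_mem _ hd)) h)
    · simp [hdZ i hi, hd'Z i hi]
    · simp [div_mul_cancel₀ _ hj]
  refine ⟨d' j / d j, fun h => hd'0 ?_, sub_eq_zero.1 key⟩
  rwa [h, zero_smul, sub_zero] at key

theorem wt_smul {a : F} (ha : a ≠ 0) (v : ι → F) : wt (a • v) = wt v := by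
  simp [wt, ha]

/-- A codeword of weight `n - k` has its zero set as the support of a dual codeword of weight `k`,
which is unique up to scaling. -/
theorem exists_unique_dual_of_wt {C : Submodule F (ι → F)} {k : ℕ} (hdim : finrank F C = k)
    (hk : k < Fintype.card ι) (hD : ∀ v ∈ dualCode C, v ≠ 0 → k ≤ wt v) (hk0 : 0 < k)
    {c : ι → F} (hc : c ∈ C) (hcw : wt c = Fintype.card ι - k) :
    ∃ d ∈ dualCode C, wt d = k ∧ (∀ i, c i ≠ 0 → d i = 0) ∧
      ∀ d' ∈ dualCode C, wt d' = k → (∀ i, c i ≠ 0 → d' i = 0) →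
        ∃ a : F, a ≠ 0 ∧ d' = a • d := by
  have hZ : (Finset.univ.filter fun i => c i = 0).card = k := by
    rw [card_filter_eq_zero]
    omega
  obtain ⟨d, hd, hd0, hdZ⟩ := exists_dualCode_ne_zero_of_vanishing (hZ.trans hdim.symm) hc
    (ne_zero_of_wt_pos (by omega)) (by simp)
  refine ⟨d, hd, le_antisymm ((wt_le_card hdZ).trans hZ.le) (hD d hd hd0),
    fun i hi => hdZ i (by simpa using hi), fun d' hd' hw hd'Z => ?_⟩
  exact exists_smul_eq_of_support_subset (by simpa only [hZ] using hD) hd hd' hd0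
    (ne_zero_of_wt_pos (hw ▸ hk0)) hdZ fun i hi => hd'Z i (by simpa using hi)

open Classical in
theorem card_dual_disjoint_support [Fintype F] {C : Submodule F (ι → F)} {k : ℕ}
    (hdim : finrank F C = k) (hk : k < Fintype.card ι)
    (hD : ∀ v ∈ dualCode C, v ≠ 0 → k ≤ wt v) (hk0 : 0 < k)
    {c : ι → F} (hc : c ∈ C) (hcw : wt c = Fintype.card ι - k) :
    (Finset.univ.filter fun d : ι → F =>
      (d ∈ dualCode C ∧ wt d = k) ∧ ∀ i, c i ≠ 0 → d i = 0).card = Fintype.card F - 1 := by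
  obtain ⟨d, hd, hdw, hdc, hu⟩ := exists_unique_dual_of_wt hdim hk hD hk0 hc hcw
  have hd0 : d ≠ 0 := ne_zero_of_wt_pos (hdw ▸ hk0)
  rw [← Fintype.card_units, ← Finset.card_univ,
    ← Finset.card_image_of_injective (f := fun a : Fˣ => (a : F) • d) _
      fun a b h => Units.ext (smul_left_injective F hd0 h)]
  congr 1
  ext d'
  simp only [Finset.mem_filter, Finset.mem_univ, true_and, Finset.mem_image]
  constructor
  · rintro ⟨⟨h1, h2⟩, h3⟩
    obtain ⟨a, ha, rfl⟩ := hu d' h1 h2 h3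
    exact ⟨Units.mk0 a ha, rfl⟩
  · rintro ⟨a, rfl⟩
    exact ⟨⟨Submodule.smul_mem _ _ hd, (wt_smul a.ne_zero d).trans hdw⟩,
      fun i hi => by simp [hdc i hi]⟩

end NearMDS

/-- **Theorem (Faldum–Willems).**  Let `C` be an `[n, k]` near MDS code over a
finite field `GF(q)`, i.e. the minimum Hamming weight of a nonzero codeword of
`C` is `n-k` and the minimum Hamming weight of a nonzero codeword of the dual
code `C^⊥` is `k`.  Then for every codeword `c` of `C` of weight `n-k` there
is a codeword `d` of `C^⊥` of weight `k` whose support is disjoint from the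
support of `c`, and `d` is unique up to a nonzero scalar multiple.  In
particular, `C` and `C^⊥` have the same number of minimum weight codewords. -/
theorem stmt_17 (n k : ℕ) (F : Type) [Field F] [Fintype F] [DecidableEq F]
    (C : Submodule F (Fin n → F))
    (hdim : Module.finrank F C = k)
    (hCmin : ∀ c ∈ C, c ≠ 0 → n - k ≤ wt c)
    (hCex : ∃ c ∈ C, c ≠ 0 ∧ wt c = n - k)
    (hDmin : ∀ v : Fin n → F, (∀ c ∈ C, ∑ i, v i * c i = 0) → v ≠ 0 → k ≤ wt v)
    (hDex : ∃ v : Fin n → F, (∀ c ∈ C, ∑ i, v i * c i = 0) ∧ v ≠ 0 ∧ wt v = k) :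
    (∀ c ∈ C, wt c = n - k →
      ∃ d : Fin n → F, (∀ c' ∈ C, ∑ i, d i * c' i = 0) ∧ wt d = k ∧
        (∀ i, c i ≠ 0 → d i = 0) ∧
        (∀ d' : Fin n → F, (∀ c' ∈ C, ∑ i, d' i * c' i = 0) → wt d' = k →
          (∀ i, c i ≠ 0 → d' i = 0) → ∃ lam : F, lam ≠ 0 ∧ d' = lam • d))
    ∧ Nat.card {c : Fin n → F // c ∈ C ∧ wt c = n - k}
        = Nat.card {v : Fin n → F // (∀ c ∈ C, ∑ i, v i * c i = 0) ∧ wt v = k} := by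
  have hn : Fintype.card (Fin n) = n := Fintype.card_fin n
  obtain ⟨c₀, -, hc₀, hc₀w⟩ := hCex
  obtain ⟨v₀, -, hv₀, hv₀w⟩ := hDex
  have hk : k < n := Nat.lt_of_sub_pos (hc₀w ▸ wt_pos hc₀)
  have hk0 : 0 < k := hv₀w ▸ wt_pos hv₀
  refine ⟨fun c hc hcw => exists_unique_dual_of_wt hdim (by rwa [hn]) hDmin hk0 hc (by rwa [hn]),
    ?_⟩
  classical
  rw [Nat.card_eq_fintype_card, Nat.card_eq_fintype_card, Fintype.card_subtype,
    Fintype.card_subtype]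
  have hq : 0 < Fintype.card F - 1 := Nat.sub_pos_of_lt Fintype.one_lt_card
  refine Nat.eq_of_mul_eq_mul_right hq <| Finset.card_mul_eq_card_mul
    (fun c d : Fin n → F => ∀ i, c i ≠ 0 → d i = 0) (fun c hc => ?_) fun d hd => ?_
  · obtain ⟨hcC, hcw⟩ := (Finset.mem_filter.1 hc).2
    rw [← card_dual_disjoint_support hdim (by rwa [hn]) hDmin hk0 hcC (by rwa [hn]),
      Finset.bipartiteAbove, Finset.filter_filter]
    congr 1
    ext d
    simp only [Finset.mem_filter, Finset.mem_univ, true_and, mem_dualCode]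
  · obtain ⟨hdD, hdw⟩ := (Finset.mem_filter.1 hd).2
    have hdim' : finrank F (dualCode C) = n - k := by rw [finrank_dualCode, hdim, hn]
    rw [← card_dual_disjoint_support hdim' (by omega) (by rwa [dualCode_dualCode])
      (by omega) (mem_dualCode.2 hdD) (by omega), Finset.bipartiteBelow, Finset.filter_filter,
      dualCode_dualCode]
    congr 1
    ext c
    simp only [Finset.mem_filter, Finset.mem_univ, true_and]
    exact and_congr_right fun _ => forall_congr' fun i => not_imp_comm
end

section
/- Let m ≥ 2, q = 2^m, and let F = GF(q). Then there is no MDS code over F with parameters [q+3, 3, q+1]; that is, every linear code over F of length q+3 and dimension 3 contains a nonzero codeword of Hamming weight at most q. -/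
/-- A vector of length `n + 3` vanishing at three distinct coordinates has weight at most `n`. -/
theorem wt_le_of_three_zeros {F : Type} [DecidableEq F] [Zero F] {n : ℕ} {v : Fin (n + 3) → F}
    {i j k : Fin (n + 3)} (hij : i ≠ j) (hik : i ≠ k) (hjk : j ≠ k)
    (hi : v i = 0) (hj : v j = 0) (hk : v k = 0) : wt v ≤ n := by
  have hsub : (Finset.univ.filter fun l => v l ≠ 0) ⊆ ({i, j, k} : Finset (Fin (n + 3)))ᶜ := by
    intro l hl
    simp only [Finset.mem_filter, Finset.mem_univ, true_and] at hl
    simp only [Finset.mem_compl, Finset.mem_insert, Finset.mem_singleton]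
    rintro (rfl | rfl | rfl) <;> contradiction
  refine (Finset.card_le_card hsub).trans ?_
  rw [Finset.card_compl, Finset.card_eq_three.mpr ⟨i, j, k, hij, hik, hjk, rfl⟩, Fintype.card_fin]
  omega

/-- A code of dimension greater than two has a nonzero codeword vanishing at any two prescribed
coordinates. -/
theorem exists_codeword_zero_at_two {ι F : Type} [Fintype ι] [Field F] (C : Submodule F (ι → F))
    (hdim : 2 < Module.finrank F C) (i j : ι) : ∃ c ∈ C, c ≠ 0 ∧ c i = 0 ∧ c j = 0 := by
  let f : C →ₗ[F] F × F :=
    ((LinearMap.proj i).prod (LinearMap.proj j) : (ι → F) →ₗ[F] F × F).comp C.subtype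
  have hker : LinearMap.ker f ≠ ⊥ := LinearMap.ker_ne_bot_of_finrank_lt (by simpa using hdim)
  obtain ⟨⟨c, hc⟩, hcf, hne⟩ := Submodule.exists_mem_ne_zero_of_ne_bot hker
  have h : (c i, c j) = ((0, 0) : F × F) := hcf
  exact ⟨c, hc, fun h0 => hne (Subtype.ext h0), congrArg Prod.fst h, congrArg Prod.snd h⟩

/-- **Theorem.**  Let `m ≥ 2`, `q = 2^m`, `F = GF(q)`.  There is no MDS code
over `F` with parameters `[q+3, 3, q+1]`: every linear code over `F` of length
`q+3` and dimension `3` contains a nonzero codeword of Hamming weight at most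
`q`. -/
theorem stmt_19 (m : ℕ) (hm : 2 ≤ m)
    (F : Type) [Field F] [Fintype F] [DecidableEq F] (hcard : Fintype.card F = 2 ^ m)
    (C : Submodule F (Fin (2 ^ m + 3) → F))
    (hdim : Module.finrank F C = 3) :
    ∃ c ∈ C, c ≠ 0 ∧ wt c ≤ 2 ^ m := by
  by_contra! hmds
  have hzeros : ∀ c ∈ C, c ≠ 0 → ∀ i j k, i ≠ j → i ≠ k → j ≠ k → c i = 0 → c j = 0 → c k ≠ 0 :=
    fun c hc hne i j k hij hik hjk hi hj hk =>
      (hmds c hc hne).not_ge (wt_le_of_three_zeros hij hik hjk hi hj hk)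
  have h01 : (0 : Fin (2 ^ m + 3)) ≠ 1 := by simp
  let z : Fin (2 ^ m + 3) := ⟨2, by omega⟩
  have h0z : 0 ≠ z := by simp [Fin.ext_iff, z]
  have h1z : 1 ≠ z := by simp [Fin.ext_iff, z]
  obtain ⟨a, haC, ha, ha0, ha1⟩ := exists_codeword_zero_at_two C (by omega) 0 1
  obtain ⟨b, hbC, hb, hb0, hbz⟩ := exists_codeword_zero_at_two C (by omega) 0 z
  have hb1 : b 1 ≠ 0 := hzeros b hbC hb 0 z 1 h0z h01 h1z.symm hb0 hbz
  let S : Finset (Fin (2 ^ m + 3)) := {0, 1}ᶜ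
  have hS : (Finset.univ : Finset F).card < S.card := by
    rw [Finset.card_univ, hcard, Finset.card_compl, Finset.card_pair h01, Fintype.card_fin]
    omega
  obtain ⟨j, hj, k, hk, hjk, hquot⟩ := Finset.exists_ne_map_eq_of_card_lt_of_maps_to hS
    (f := fun l => b l / a l) (fun _ _ => Finset.mem_coe.mpr (Finset.mem_univ _))
  simp only [S, Finset.mem_compl, Finset.mem_insert, Finset.mem_singleton, not_or] at hj hk
  have haj : a j ≠ 0 := hzeros a haC ha 0 1 j h01 (Ne.symm hj.1) (Ne.symm hj.2) ha0 ha1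
  have hak : a k ≠ 0 := hzeros a haC ha 0 1 k h01 (Ne.symm hk.1) (Ne.symm hk.2) ha0 ha1
  let c := b - (b j / a j) • a
  have hc : c ≠ 0 := fun h => hb1 (by simpa [c, ha1] using congrFun h 1)
  refine hzeros c (C.sub_mem hbC (C.smul_mem _ haC)) hc 0 j k (Ne.symm hj.1) (Ne.symm hk.1) hjk
    (by simp [c, ha0, hb0]) (by simp [c, haj]) ?_
  change b k - b j / a j * a k = 0
  rw [hquot, div_mul_cancel₀ _ hak, sub_self]
end
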